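/- Let F be a C^∞ antisymmetric 2-form field on ℝⁿ (F_{μν} : ℝⁿ → ℝ with F_{μν} = −F_{νμ}) satisfying the source-free Maxwell equations ∂_τ F_{μν} + ∂_μ F_{ντ} + ∂_ν F_{τμ} = 0 and η^{ρμ} ∂_ρ F_{μν} = 0 everywhere. Then the super-energy tensor field E_{αβλμ} of F is divergence-free in both index pairs: η^{ρα} ∂_ρ E_{αβλμ} = 0 and η^{ρλ} ∂_ρ E_{αβλμ} = 0 at every point, for all remaining indices. -/

import Mathlib

open Finset

noncomputable section

/-- Components of the Minkowski metric (and of its inverse) in dimension `n`. -/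
def gmet (n : ℕ) (μ ν : Fin n) : ℝ :=
  if μ = ν then (if (μ : ℕ) = 0 then -1 else 1) else 0

/-- The partial derivative `∂_μ f` of a scalar field on flat spacetime `ℝⁿ`. -/
def pd (n : ℕ) (μ : Fin n) (f : (Fin n → ℝ) → ℝ) : (Fin n → ℝ) → ℝ :=
  fun x => fderiv ℝ f x (Pi.single μ 1)

/-- The super-energy tensor field `E_{αβλμ}` of an electromagnetic field `F` on flat
spacetime. -/
def seE (n : ℕ) (F : (Fin n → ℝ) → Fin n → Fin n → ℝ)
    (α β lam mu : Fin n) (x : Fin n → ℝ) : ℝ :=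
  (∑ ρ : Fin n, ∑ ρ' : Fin n,
      gmet n ρ ρ' * pd n α (fun y => F y lam ρ) x * pd n β (fun y => F y mu ρ') x)
    + (∑ ρ : Fin n, ∑ ρ' : Fin n,
        gmet n ρ ρ' * pd n α (fun y => F y mu ρ) x * pd n β (fun y => F y lam ρ') x)
    - gmet n α β *
        (∑ σ : Fin n, ∑ σ' : Fin n, ∑ ρ : Fin n, ∑ ρ' : Fin n,
          gmet n σ σ' * gmet n ρ ρ' *
            pd n σ (fun y => F y lam ρ) x * pd n σ' (fun y => F y mu ρ') x)
    - (1 / 2) * gmet n lam mu *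
        (∑ σ : Fin n, ∑ σ' : Fin n, ∑ ρ : Fin n, ∑ ρ' : Fin n,
          gmet n σ σ' * gmet n ρ ρ' *
            pd n α (fun y => F y σ ρ) x * pd n β (fun y => F y σ' ρ') x)
    + (1 / 4) * gmet n α β * gmet n lam mu *
        (∑ τ : Fin n, ∑ τ' : Fin n, ∑ σ : Fin n, ∑ σ' : Fin n, ∑ ρ : Fin n, ∑ ρ' : Fin n,
          gmet n τ τ' * gmet n σ σ' * gmet n ρ ρ' *
            pd n τ (fun y => F y σ ρ) x * pd n τ' (fun y => F y σ' ρ') x)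


def se (n : ℕ) (i : Fin n) : ℝ := if (i : ℕ) = 0 then -1 else 1

lemma se_sq (n : ℕ) (i : Fin n) : se n i * se n i = 1 := by
  unfold se; split_ifs <;> norm_num

lemma gmet_eq (n : ℕ) (i j : Fin n) : gmet n i j = if i = j then se n i else 0 := rfl

lemma sum_gmet (n : ℕ) (i : Fin n) (f : Fin n → ℝ) :
    ∑ j, gmet n i j * f j = se n i * f i := by
  simp [gmet_eq]

lemma sum_gmet' (n : ℕ) (j : Fin n) (f : Fin n → ℝ) :
    ∑ i, se n i * (gmet n i j * f i) = f j := by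
  simp [gmet_eq, ← mul_assoc, se_sq]

lemma seE_eq (n : ℕ) (F : (Fin n → ℝ) → Fin n → Fin n → ℝ) (α β lam mu : Fin n) :
    seE n F α β lam mu = fun x =>
      (∑ r, se n r * (pd n α (fun y => F y lam r) x * pd n β (fun y => F y mu r) x))
      + (∑ r, se n r * (pd n α (fun y => F y mu r) x * pd n β (fun y => F y lam r) x))
      - gmet n α β * (∑ s, ∑ r, se n s * se n r *
          (pd n s (fun y => F y lam r) x * pd n s (fun y => F y mu r) x))
      - (1 / 2 * gmet n lam mu) * (∑ s, ∑ r, se n s * se n r *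
          (pd n α (fun y => F y s r) x * pd n β (fun y => F y s r) x))
      + (1 / 4 * gmet n α β * gmet n lam mu) * (∑ t, ∑ s, ∑ r, se n t * se n s * se n r *
          (pd n t (fun y => F y s r) x * pd n t (fun y => F y s r) x)) := by
  funext x
  unfold seE
  simp [gmet_eq, mul_assoc, ← Finset.mul_sum]

lemma two_le_top' : (2 : WithTop ℕ∞) ≤ ((⊤ : ℕ∞) : WithTop ℕ∞) :=
  WithTop.coe_le_coe.2 (le_top : (2 : ℕ∞) ≤ ⊤)

lemma two_le_top : (1 + 1 : WithTop ℕ∞) ≤ ((⊤ : ℕ∞) : WithTop ℕ∞) := by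
  rw [one_add_one_eq_two]; exact two_le_top'

lemma pd_diff (n : ℕ) (f : (Fin n → ℝ) → ℝ) (hf : ContDiff ℝ (⊤ : ℕ∞) f) (a : Fin n) :
    Differentiable ℝ (pd n a f) := by
  have h1 : ContDiff ℝ 1 (fderiv ℝ f) := hf.fderiv_right two_le_top
  exact (h1.differentiable one_ne_zero).clm_apply (differentiable_const _)

lemma pd_symm (n : ℕ) (f : (Fin n → ℝ) → ℝ) (hf : ContDiff ℝ (⊤ : ℕ∞) f) (a b : Fin n)
    (x : Fin n → ℝ) : pd n a (pd n b f) x = pd n b (pd n a f) x := by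
  have h1 : ContDiff ℝ 1 (fderiv ℝ f) := hf.fderiv_right two_le_top
  have hd : DifferentiableAt ℝ (fderiv ℝ f) x := h1.differentiable one_ne_zero x
  have key : ∀ u v : Fin n, pd n u (pd n v f) x
      = fderiv ℝ (fderiv ℝ f) x (Pi.single u 1) (Pi.single v 1) := by
    intro u v
    unfold pd
    rw [fderiv_clm_apply hd (differentiableAt_const _)]
    simp
  rw [key, key]
  have hs : IsSymmSndFDerivAt ℝ f x := by
    apply ContDiffAt.isSymmSndFDerivAt (n := (⊤ : ℕ∞)) hf.contDiffAt
    simpa using two_le_top'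
  exact hs _ _

lemma pd_seE (n : ℕ) (F : (Fin n → ℝ) → Fin n → Fin n → ℝ)
    (hFs : ∀ μ ν : Fin n, ContDiff ℝ (⊤ : ℕ∞) (fun x => F x μ ν))
    (D : Fin n → Fin n → Fin n → ℝ) (H : Fin n → Fin n → Fin n → Fin n → ℝ)
    (x : Fin n → ℝ)
    (hD : ∀ a i j, D a i j = pd n a (fun y => F y i j) x)
    (hH : ∀ b a i j, H b a i j = pd n b (pd n a (fun y => F y i j)) x)
    (p α β lam mu : Fin n) :
    pd n p (seE n F α β lam mu) x =
      (∑ r, se n r * (D α lam r * H p β mu r + D β mu r * H p α lam r))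
      + (∑ r, se n r * (D α mu r * H p β lam r + D β lam r * H p α mu r))
      - gmet n α β * (∑ s, ∑ r, se n s * se n r *
          (D s lam r * H p s mu r + D s mu r * H p s lam r))
      - (1 / 2 * gmet n lam mu) * (∑ s, ∑ r, se n s * se n r *
          (D α s r * H p β s r + D β s r * H p α s r))
      + (1 / 4 * gmet n α β * gmet n lam mu) * (∑ t, ∑ s, ∑ r, se n t * se n s * se n r *
          (D t s r * H p t s r + D t s r * H p t s r)) := by
  have hd : ∀ a i j, HasFDerivAt (pd n a (fun y => F y i j))
      (fderiv ℝ (pd n a (fun y => F y i j)) x) x :=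
    fun a i j => (pd_diff n _ (hFs i j) a x).hasFDerivAt
  have h2 : ∀ a i j b k l, HasFDerivAt
      (fun x => pd n a (fun y => F y i j) x * pd n b (fun y => F y k l) x) _ x :=
    fun a i j b k l => (hd a i j).mul (hd b k l)
  rw [seE_eq]
  have := ((((HasFDerivAt.fun_sum (u := Finset.univ) fun r _ =>
        (h2 α lam r β mu r).const_mul (se n r)).add
      (HasFDerivAt.fun_sum (u := Finset.univ) fun r _ =>
        (h2 α mu r β lam r).const_mul (se n r))).sub
      ((HasFDerivAt.fun_sum (u := Finset.univ) fun s _ =>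
        HasFDerivAt.fun_sum (u := Finset.univ) fun r _ =>
        (h2 s lam r s mu r).const_mul (se n s * se n r)).const_mul (gmet n α β))).sub
      ((HasFDerivAt.fun_sum (u := Finset.univ) fun s _ =>
        HasFDerivAt.fun_sum (u := Finset.univ) fun r _ =>
        (h2 α s r β s r).const_mul (se n s * se n r)).const_mul (1 / 2 * gmet n lam mu))).add
      ((HasFDerivAt.fun_sum (u := Finset.univ) fun t _ =>
        HasFDerivAt.fun_sum (u := Finset.univ) fun s _ =>
        HasFDerivAt.fun_sum (u := Finset.univ) fun r _ =>
        (h2 t s r t s r).const_mul (se n t * se n s * se n r)).const_mul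
          (1 / 4 * gmet n α β * gmet n lam mu))
  have h3 := this.fderiv
  have h4 := congrArg (fun L => L (Pi.single p (1 : ℝ))) h3
  refine h4.trans ?_
  simp only [hD, hH, pd, ContinuousLinearMap.add_apply, ContinuousLinearMap.sub_apply,
    ContinuousLinearMap.smul_apply, ContinuousLinearMap.sum_apply, smul_eq_mul]

lemma algA (n : ℕ) (D : Fin n → Fin n → Fin n → ℝ) (H : Fin n → Fin n → Fin n → Fin n → ℝ)
    (hs : ∀ a b i j, H a b i j = H b a i j)
    (box : ∀ i j, ∑ a, se n a * H a a i j = 0) (β lam mu : Fin n) :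
    ∑ p, se n p * (
      (∑ r, se n r * (D p lam r * H p β mu r + D β mu r * H p p lam r))
      + (∑ r, se n r * (D p mu r * H p β lam r + D β lam r * H p p mu r))
      - gmet n p β * (∑ s, ∑ r, se n s * se n r *
          (D s lam r * H p s mu r + D s mu r * H p s lam r))
      - (1 / 2 * gmet n lam mu) * (∑ s, ∑ r, se n s * se n r *
          (D p s r * H p β s r + D β s r * H p p s r))
      + (1 / 4 * gmet n p β * gmet n lam mu) * (∑ t, ∑ s, ∑ r, se n t * se n s * se n r *
          (D t s r * H p t s r + D t s r * H p t s r))) = 0 := by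
  have b1 : ∀ i k : Fin n, ∑ p, se n p * (∑ r, se n r * (D p i r * H p β k r + D β k r * H p p i r))
      = ∑ p, ∑ r, se n p * se n r * (D p i r * H β p k r) := by
    intro i k
    have z : ∑ p, ∑ r, (se n r * D β k r) * (se n p * H p p i r) = 0 := by
      rw [Finset.sum_comm]
      simp [← Finset.mul_sum, box]
    rw [← add_zero (∑ p, ∑ r, se n p * se n r * (D p i r * H β p k r)), ← z,
      ← Finset.sum_add_distrib]
    refine Finset.sum_congr rfl fun p _ => ?_
    rw [Finset.mul_sum, ← Finset.sum_add_distrib]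
    refine Finset.sum_congr rfl fun r _ => ?_
    rw [hs β p]; ring
  have b4 : ∑ p, se n p * (∑ s, ∑ r, se n s * se n r *
          (D p s r * H p β s r + D β s r * H p p s r))
      = ∑ p, ∑ s, ∑ r, se n p * se n s * se n r * (D p s r * H β p s r) := by
    have z : ∑ p, ∑ s, ∑ r, (se n s * se n r * D β s r) * (se n p * H p p s r) = 0 := by
      rw [Finset.sum_comm]
      refine Finset.sum_eq_zero fun s _ => ?_
      rw [Finset.sum_comm]
      simp [← Finset.mul_sum, box]
    rw [← add_zero (∑ p, ∑ s, ∑ r, se n p * se n s * se n r * (D p s r * H β p s r)), ← z,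
      ← Finset.sum_add_distrib]
    refine Finset.sum_congr rfl fun p _ => ?_
    rw [Finset.mul_sum, ← Finset.sum_add_distrib]
    refine Finset.sum_congr rfl fun s _ => ?_
    rw [Finset.mul_sum, ← Finset.sum_add_distrib]
    refine Finset.sum_congr rfl fun r _ => ?_
    rw [hs β p]; ring
  have c3 := sum_gmet' n β (fun p => ∑ s, ∑ r, se n s * se n r *
          (D s lam r * H p s mu r + D s mu r * H p s lam r))
  have c5 := sum_gmet' n β (fun p => ∑ t, ∑ s, ∑ r, se n t * se n s * se n r *
          (D t s r * H p t s r + D t s r * H p t s r))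
  simp only [mul_add, Finset.sum_add_distrib] at b1 b4 c3 c5
  have e4 : ∀ X : Fin n → ℝ, ∑ p, se n p * ((1 / 2 * gmet n lam mu) * X p)
      = (1 / 2 * gmet n lam mu) * ∑ p, se n p * X p := by
    intro X; rw [Finset.mul_sum]; exact Finset.sum_congr rfl fun p _ => by ring
  have e5 : ∀ X : Fin n → ℝ, ∑ p, se n p * ((1 / 4 * gmet n p β * gmet n lam mu) * X p)
      = (1 / 4 * gmet n lam mu) * ∑ p, se n p * (gmet n p β * X p) := by
    intro X; rw [Finset.mul_sum]; exact Finset.sum_congr rfl fun p _ => by ring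
  simp only [mul_add, mul_sub, Finset.sum_add_distrib, Finset.sum_sub_distrib, e4, e5]
  have b1' := b1 lam mu
  have b1'' := b1 mu lam
  linear_combination b1' + b1'' - c3 - (1 / 2 * gmet n lam mu) * b4
    + (1 / 4 * gmet n lam mu) * c5

lemma antisum (n : ℕ) (A : Fin n → Fin n → ℝ) (B C : Fin n → Fin n → ℝ)
    (hA : ∀ i j, A i j = - A j i) (hB : ∀ l r, B l r - B r l = C l r) :
    ∑ l, ∑ r, se n l * se n r * (A l r * B l r)
      = 1 / 2 * ∑ l, ∑ r, se n l * se n r * (A l r * C l r) := by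
  have h : ∑ l, ∑ r, se n l * se n r * (A l r * B l r)
      = ∑ l, ∑ r, - (se n l * se n r * (A l r * B r l)) := by
    rw [Finset.sum_comm]
    refine Finset.sum_congr rfl fun l _ => Finset.sum_congr rfl fun r _ => ?_
    rw [hA r l]; ring
  have h2 : ∑ l, ∑ r, se n l * se n r * (A l r * C l r)
      = ∑ l, ∑ r, se n l * se n r * (A l r * B l r)
        + ∑ l, ∑ r, - (se n l * se n r * (A l r * B r l)) := by
    simp only [← Finset.sum_add_distrib]
    refine Finset.sum_congr rfl fun l _ => Finset.sum_congr rfl fun r _ => ?_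
    rw [← hB]; ring
  rw [h2, ← h]; ring

lemma algB (n : ℕ) (D : Fin n → Fin n → Fin n → ℝ) (H : Fin n → Fin n → Fin n → Fin n → ℝ)
    (hs : ∀ a b i j, H a b i j = H b a i j)
    (hDa : ∀ a i j, D a i j = - D a j i)
    (hHa : ∀ a b i j, H a b i j = - H a b j i)
    (hB : ∀ a t m v, H a t m v + H a m v t + H a v t m = 0)
    (hM : ∀ a v, ∑ r, se n r * H a r r v = 0) (α β mu : Fin n) :
    ∑ p, se n p * (
      (∑ r, se n r * (D α p r * H p β mu r + D β mu r * H p α p r))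
      + (∑ r, se n r * (D α mu r * H p β p r + D β p r * H p α mu r))
      - gmet n α β * (∑ s, ∑ r, se n s * se n r *
          (D s p r * H p s mu r + D s mu r * H p s p r))
      - (1 / 2 * gmet n p mu) * (∑ s, ∑ r, se n s * se n r *
          (D α s r * H p β s r + D β s r * H p α s r))
      + (1 / 4 * gmet n α β * gmet n p mu) * (∑ t, ∑ s, ∑ r, se n t * se n s * se n r *
          (D t s r * H p t s r + D t s r * H p t s r))) = 0 := by
  have key : ∀ a b, ∑ p, ∑ r, se n p * se n r * (D a p r * H p b mu r)
      = 1 / 2 * ∑ s, ∑ r, se n s * se n r * (D a s r * H mu b s r) := by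
    intro a b
    refine antisum n (D a) (fun p r => H p b mu r) (fun s r => H mu b s r) (hDa a) ?_
    intro l r
    have := hB b l mu r
    rw [hs l b, hs r b, hs mu b, hHa b r mu l, hHa b mu l r]
    linarith [hHa b r l mu]
  have zero : ∀ a b, ∑ p, ∑ r, se n p * se n r * (D a mu r * H p b p r) = 0 := by
    intro a b
    rw [Finset.sum_comm]
    refine Finset.sum_eq_zero fun r _ => ?_
    have : ∑ p, se n p * se n r * (D a mu r * H p b p r)
        = (se n r * D a mu r) * ∑ p, se n p * H b p p r := by
      rw [Finset.mul_sum]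
      refine Finset.sum_congr rfl fun p _ => ?_
      rw [hs p b]; ring
    rw [this, hM, mul_zero]
  have t1 : ∀ a b, ∑ p, se n p * (∑ r, se n r * (D a p r * H p b mu r + D b mu r * H p a p r))
      = 1 / 2 * ∑ s, ∑ r, se n s * se n r * (D a s r * H mu b s r) := by
    intro a b
    rw [← key, ← add_zero (∑ p, ∑ r, _), ← zero b a, ← Finset.sum_add_distrib]
    refine Finset.sum_congr rfl fun p _ => ?_
    rw [Finset.mul_sum, ← Finset.sum_add_distrib]
    exact Finset.sum_congr rfl fun r _ => by ring
  have t1' := t1 α β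
  have t2' : ∑ p, se n p * (∑ r, se n r * (D α mu r * H p β p r + D β p r * H p α mu r))
      = 1 / 2 * ∑ s, ∑ r, se n s * se n r * (D β s r * H mu α s r) := by
    rw [← t1 β α]
    simp only [add_comm]
  have t3 : ∑ p, se n p * (∑ s, ∑ r, se n s * se n r *
          (D s p r * H p s mu r + D s mu r * H p s p r))
      = 1 / 2 * ∑ t, ∑ s, ∑ r, se n t * se n s * se n r * (D t s r * H mu t s r) := by
    simp only [Finset.mul_sum]
    rw [Finset.sum_comm]
    refine Finset.sum_congr rfl fun s _ => ?_
    have := congrArg (fun z => se n s * z) (t1 s s)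
    simp only [Finset.mul_sum] at this
    refine Eq.trans ?_ (this.trans ?_)
    · exact Finset.sum_congr rfl fun p _ => Finset.sum_congr rfl fun r _ => by ring
    · exact Finset.sum_congr rfl fun p _ => Finset.sum_congr rfl fun r _ => by ring
  have c4 := sum_gmet' n mu (fun p => ∑ s, ∑ r, se n s * se n r *
          (D α s r * H p β s r + D β s r * H p α s r))
  have c5 := sum_gmet' n mu (fun p => ∑ t, ∑ s, ∑ r, se n t * se n s * se n r *
          (D t s r * H p t s r + D t s r * H p t s r))
  have e3 : ∀ X : Fin n → ℝ, ∑ p, se n p * (gmet n α β * X p)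
      = gmet n α β * ∑ p, se n p * X p := by
    intro X; rw [Finset.mul_sum]; exact Finset.sum_congr rfl fun p _ => by ring
  have e4 : ∀ X : Fin n → ℝ, ∑ p, se n p * ((1 / 2 * gmet n p mu) * X p)
      = (1 / 2) * ∑ p, se n p * (gmet n p mu * X p) := by
    intro X; rw [Finset.mul_sum]; exact Finset.sum_congr rfl fun p _ => by ring
  have e5 : ∀ X : Fin n → ℝ, ∑ p, se n p * ((1 / 4 * gmet n α β * gmet n p mu) * X p)
      = (1 / 4 * gmet n α β) * ∑ p, se n p * (gmet n p mu * X p) := by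
    intro X; rw [Finset.mul_sum]; exact Finset.sum_congr rfl fun p _ => by ring
  simp only [mul_add, Finset.sum_add_distrib] at t1' t2' t3 c4 c5
  simp only [mul_add, mul_sub, Finset.sum_add_distrib, Finset.sum_sub_distrib, e3, e4, e5]
  linear_combination t1' + t2' - gmet n α β * t3 - (1 / 2) * c4 + (1 / 4 * gmet n α β) * c5

/-- the super-energy tensor field of a smooth source-free Maxwell field on
flat spacetime is divergence-free in both index pairs. -/
theorem seE_divergence_free
    (n : ℕ) (F : (Fin n → ℝ) → Fin n → Fin n → ℝ)
    (hFs : ∀ μ ν : Fin n, ContDiff ℝ (⊤ : ℕ∞) (fun x => F x μ ν))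
    (hFa : ∀ (x : Fin n → ℝ) (μ ν : Fin n), F x μ ν = - F x ν μ)
    (hM1 : ∀ (x : Fin n → ℝ) (τ μ ν : Fin n),
      pd n τ (fun y => F y μ ν) x + pd n μ (fun y => F y ν τ) x
        + pd n ν (fun y => F y τ μ) x = 0)
    (hM2 : ∀ (x : Fin n → ℝ) (ν : Fin n),
      (∑ ρ : Fin n, ∑ μ : Fin n, gmet n ρ μ * pd n ρ (fun y => F y μ ν) x) = 0) :
    (∀ (x : Fin n → ℝ) (β lam mu : Fin n),
      (∑ ρ : Fin n, ∑ α : Fin n, gmet n ρ α * pd n ρ (seE n F α β lam mu) x) = 0) ∧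
    (∀ (x : Fin n → ℝ) (α β mu : Fin n),
      (∑ ρ : Fin n, ∑ lam : Fin n, gmet n ρ lam * pd n ρ (seE n F α β lam mu) x) = 0) := by
  have hdf : ∀ a i j, Differentiable ℝ (pd n a (fun y => F y i j)) :=
    fun a i j => pd_diff n _ (hFs i j) a
  have aD : ∀ x a i j, pd n a (fun y => F y i j) x = - pd n a (fun y => F y j i) x := by
    intro x a i j
    have : (fun y => F y i j) = fun y => - F y j i := by funext y; exact hFa y i j
    rw [this]; unfold pd; rw [fderiv_fun_neg]; rfl
  have aH : ∀ x b a i j, pd n b (pd n a (fun y => F y i j)) x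
      = - pd n b (pd n a (fun y => F y j i)) x := by
    intro x b a i j
    have : pd n a (fun y => F y i j) = fun x => - pd n a (fun y => F y j i) x := by
      funext x; exact aD x a i j
    rw [this]
    change fderiv ℝ _ x _ = _
    rw [fderiv_fun_neg]; rfl
  have sH : ∀ x a b i j, pd n a (pd n b (fun y => F y i j)) x
      = pd n b (pd n a (fun y => F y i j)) x :=
    fun x a b i j => pd_symm n _ (hFs i j) a b x
  have bH : ∀ x a t m v, pd n a (pd n t (fun y => F y m v)) x
      + pd n a (pd n m (fun y => F y v t)) x + pd n a (pd n v (fun y => F y t m)) x = 0 := by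
    intro x a t m v
    have h := (((hdf t m v x).hasFDerivAt.add (hdf m v t x).hasFDerivAt).add
      (hdf v t m x).hasFDerivAt)
    have h0 : pd n t (fun y => F y m v) + pd n m (fun y => F y v t) + pd n v (fun y => F y t m)
        = fun _ => (0 : ℝ) := by funext y; exact hM1 y t m v
    rw [h0] at h
    have h4 := congrArg (fun L => L (Pi.single a (1 : ℝ))) (h.unique (hasFDerivAt_const 0 x))
    simpa [pd] using h4
  have mH : ∀ x a v, ∑ r, se n r * pd n a (pd n r (fun y => F y r v)) x = 0 := by
    intro x a v
    have h := HasFDerivAt.fun_sum (u := Finset.univ) fun r _ =>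
      ((hdf r r v x).hasFDerivAt).const_mul (se n r)
    have h0 : (fun y => ∑ r, se n r * pd n r (fun y => F y r v) y) = fun _ => (0 : ℝ) := by
      funext y
      have := hM2 y v
      simpa only [sum_gmet] using this
    rw [h0] at h
    have h4 := congrArg (fun L => L (Pi.single a (1 : ℝ))) (h.unique (hasFDerivAt_const 0 x))
    simpa [pd] using h4
  have box : ∀ x i j, ∑ a, se n a * pd n a (pd n a (fun y => F y i j)) x = 0 := by
    intro x i j
    have e : ∑ a, se n a * pd n a (pd n a (fun y => F y i j)) x
        = ∑ a, se n a * pd n i (pd n a (fun y => F y a j)) x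
          - ∑ a, se n a * pd n j (pd n a (fun y => F y a i)) x := by
      rw [← Finset.sum_sub_distrib]
      refine Finset.sum_congr rfl fun a _ => ?_
      have h1 := bH x a a i j
      rw [aH x a i j a, sH x a i, sH x a j] at h1
      linear_combination se n a * h1
    rw [e, mH, mH, sub_zero]
  constructor
  · intro x β lam mu
    simp only [sum_gmet]
    simp only [pd_seE n F hFs (fun a i j => pd n a (fun y => F y i j) x)
      (fun b a i j => pd n b (pd n a (fun y => F y i j)) x) x (fun _ _ _ => rfl)
      (fun _ _ _ _ => rfl)]
    exact algA n (fun a i j => pd n a (fun y => F y i j) x)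
      (fun b a i j => pd n b (pd n a (fun y => F y i j)) x) (sH x) (box x) β lam mu
  · intro x α β mu
    simp only [sum_gmet]
    simp only [pd_seE n F hFs (fun a i j => pd n a (fun y => F y i j) x)
      (fun b a i j => pd n b (pd n a (fun y => F y i j)) x) x (fun _ _ _ => rfl)
      (fun _ _ _ _ => rfl)]
    exact algB n (fun a i j => pd n a (fun y => F y i j) x)
      (fun b a i j => pd n b (pd n a (fun y => F y i j)) x) (sH x) (aD x) (aH x) (bH x) (mH x)
      α β mu
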